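/- arXiv:2302.12140 — 2 statements merged into one kernel-verified Lean document; each statement's English description precedes it below -/
import Mathlib

section
/- Assume n ≥ 3. An SDS on the Condorcet domain D_C is group-strategyproof and non-imposing if and only if it is a dictatorship d_i for some voter i or the Condorcet rule COND. -/
open scoped Classical
open Finset

/-- A preference relation: a complete, transitive, and antisymmetric binary relation. -/
def IsPref {A : Type*} (r : A → A → Prop) : Prop :=
  (∀ x y : A, x ≠ y → r x y ∨ r y x) ∧
  (∀ x y z : A, r x y → r y z → r x z) ∧
  (∀ x y : A, r x y → ¬ r y x)

/-- A preference profile for `n` voters over alternatives `A`. -/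
abbrev Prof (n : ℕ) (A : Type*) := Fin n → A → A → Prop

/-- Every voter's relation is a preference relation. -/
def IsProf {n : ℕ} {A : Type*} (R : Prof n A) : Prop := ∀ i, IsPref (R i)

/-- The majority margin `g_R(x,y)`. -/
noncomputable def margin {n : ℕ} {A : Type*} (R : Prof n A) (x y : A) : ℤ :=
  (Nat.card {i : Fin n // R i x y} : ℤ) - (Nat.card {i : Fin n // R i y x} : ℤ)

/-- `x` is the Condorcet winner of `R`. -/
def CondorcetWinner {n : ℕ} {A : Type*} (R : Prof n A) (x : A) : Prop :=
  ∀ y, y ≠ x → 0 < margin R x y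

/-- The Condorcet domain: all profiles admitting a Condorcet winner. -/
def CondorcetDomain (n : ℕ) (A : Type*) : Set (Prof n A) :=
  {R | IsProf R ∧ ∃ x, CondorcetWinner R x}

/-- The `(n+1)`-voter profile `(R, ▷)` obtained from `R` by adding `t` as an extra voter. -/
def tieProf {n : ℕ} {A : Type*} (R : Prof n A) (t : A → A → Prop) : Prof (n + 1) A :=
  Fin.cons t R

/-- The tie-breaking Condorcet domain `D_C^▷`. -/
def TieCondorcetDomain (n : ℕ) {A : Type*} (t : A → A → Prop) : Set (Prof n A) :=
  {R | IsProf R ∧ ∃ x, CondorcetWinner (tieProf R t) x}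

/-- Upper contour set `U(≻, x)`. -/
def UC {A : Type*} (r : A → A → Prop) (x : A) : Set A := {y | r y x ∨ y = x}

/-- Probability that the lottery `p` assigns to the set `S`. -/
noncomputable def mass {A : Type*} [Fintype A] (p : A → ℝ) (S : Set A) : ℝ :=
  ∑ y, S.indicator p y

/-- Stochastic dominance `p ≿^SD q` w.r.t. the preference relation `r`. -/
def SDdom {A : Type*} [Fintype A] (r : A → A → Prop) (p q : A → ℝ) : Prop :=
  ∀ x, mass q (UC r x) ≤ mass p (UC r x)

/-- `f` is a social decision scheme on the domain `D`: on `D` it returns lotteries. -/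
def IsSDS {n : ℕ} {A : Type*} [Fintype A] (D : Set (Prof n A))
    (f : Prof n A → A → ℝ) : Prop :=
  ∀ R ∈ D, (∀ x, 0 ≤ f R x) ∧ (∑ x, f R x) = 1

/-- Strategyproofness of `f` on `D`. -/
def Strategyproof {n : ℕ} {A : Type*} [Fintype A] (D : Set (Prof n A))
    (f : Prof n A → A → ℝ) : Prop :=
  ∀ R ∈ D, ∀ R' ∈ D, ∀ i : Fin n,
    (∀ j, j ≠ i → R j = R' j) → SDdom (R i) (f R) (f R')

/-- Group-strategyproofness of `f` on `D`. -/
def GroupStrategyproof {n : ℕ} {A : Type*} [Fintype A] (D : Set (Prof n A))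
    (f : Prof n A → A → ℝ) : Prop :=
  ∀ R ∈ D, ∀ R' ∈ D, ∀ I : Finset (Fin n), I.Nonempty →
    (∀ j ∉ I, R j = R' j) → ∃ i ∈ I, SDdom (R i) (f R) (f R')

/-- Non-imposition of `f` on `D`. -/
def NonImposing {n : ℕ} {A : Type*} [Fintype A] (D : Set (Prof n A))
    (f : Prof n A → A → ℝ) : Prop :=
  ∀ x : A, ∃ R ∈ D, f R x = 1

/-- Ex post efficiency of `f` on `D`. -/
def ExPostEfficient {n : ℕ} {A : Type*} [Fintype A] (D : Set (Prof n A))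
    (f : Prof n A → A → ℝ) : Prop :=
  ∀ R ∈ D, ∀ x y : A, (∀ i, R i x y) → f R y = 0

/-- `x` is top-ranked by the preference relation `r`. -/
def TopRanked {A : Type*} (r : A → A → Prop) (x : A) : Prop := ∀ y, y ≠ x → r x y

/-- The dictatorship of voter `i`. -/
noncomputable def dict {n : ℕ} {A : Type*} [Fintype A] (i : Fin n) (R : Prof n A) : A → ℝ :=
  fun x => if TopRanked (R i) x then 1 else 0

/-- The Condorcet rule `COND`. -/
noncomputable def CondRule {n : ℕ} {A : Type*} [Fintype A] : Prof n A → A → ℝ :=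
  fun R x => if CondorcetWinner R x then 1 else 0

/-- The tie-breaking Condorcet rule `COND^▷`. -/
noncomputable def TieCondRule {n : ℕ} {A : Type*} [Fintype A] (t : A → A → Prop) :
    Prof n A → A → ℝ :=
  fun R x => if CondorcetWinner (tieProf R t) x then 1 else 0

/-- The relation obtained from `r` by swapping the (adjacent) alternatives `x ≻ y`. -/
def swapRel {A : Type*} (r : A → A → Prop) (x y : A) : A → A → Prop :=
  fun a b => (a = y ∧ b = x) ∨ (r a b ∧ ¬(a = x ∧ b = y))

/-- `R'` arises from `R` by letting voter `i` swap the adjacent alternatives `x ≻_i y`,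
i.e., `R' = R^{i:yx}`. -/
def AdjSwap {n : ℕ} {A : Type*} (R R' : Prof n A) (i : Fin n) (x y : A) : Prop :=
  x ≠ y ∧ R i x y ∧ (∀ z, z ≠ x → z ≠ y → ¬(R i x z ∧ R i z y)) ∧
  R' i = swapRel (R i) x y ∧ (∀ j, j ≠ i → R' j = R j)

/-- A single ad-path step inside `D`. -/
def Step {n : ℕ} {A : Type*} (D : Set (Prof n A)) (R R' : Prof n A) : Prop :=
  R ∈ D ∧ R' ∈ D ∧ ∃ i x y, AdjSwap R R' i x y

/-- A single ad-path step inside `D` in which the alternative `a` is not swapped. -/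
def StepAvoiding {n : ℕ} {A : Type*} (D : Set (Prof n A)) (a : A) (R R' : Prof n A) : Prop :=
  R ∈ D ∧ R' ∈ D ∧ ∃ i x y, AdjSwap R R' i x y ∧ x ≠ a ∧ y ≠ a

/-- There is an ad-path from `R` to `R'` inside `D`. -/
def AdPath {n : ℕ} {A : Type*} (D : Set (Prof n A)) (R R' : Prof n A) : Prop :=
  R ∈ D ∧ R' ∈ D ∧ Relation.ReflTransGen (Step D) R R'

/-- There is an ad-path from `R` to `R'` inside `D` along which `a` is never swapped. -/
def AdPathAvoiding {n : ℕ} {A : Type*} (D : Set (Prof n A)) (a : A) (R R' : Prof n A) : Prop :=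
  R ∈ D ∧ R' ∈ D ∧ Relation.ReflTransGen (StepAvoiding D a) R R'

/-- `D` is weakly connected. -/
def WeaklyConnected {n : ℕ} {A : Type*} (D : Set (Prof n A)) : Prop :=
  ∀ R ∈ D, ∀ R' ∈ D, AdPath D R R'

/-- `D` is connected. -/
def Connected {n : ℕ} {A : Type*} (D : Set (Prof n A)) : Prop :=
  WeaklyConnected D ∧
  ∀ a : A, ∀ R ∈ D, ∀ R' ∈ D, (∀ i, UC (R i) a = UC (R' i) a) → AdPathAvoiding D a R R'

section GroupStrategyproof

variable {n : ℕ} {A : Type*}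

/-! ### Preference relations -/

/-- The relation obtained from `r` by moving `x` to the top. -/
def moveTop (r : A → A → Prop) (x : A) : A → A → Prop :=
  fun a b => (a = x ∧ b ≠ x) ∨ (r a b ∧ a ≠ x ∧ b ≠ x)

theorem IsPref.moveTop {r : A → A → Prop} (hr : IsPref r) (x : A) : IsPref (moveTop r x) := by
  obtain ⟨h1, h2, h3⟩ := hr
  refine ⟨fun a b hab => ?_, fun a b c => ?_, fun a b => ?_⟩
  · have := h1 a b hab
    unfold _root_.moveTop
    by_cases ha : a = x <;> by_cases hb : b = x <;> simp_all
  · have := h2 a b c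
    unfold _root_.moveTop
    tauto
  · have := h3 a b
    unfold _root_.moveTop
    tauto

theorem topRanked_moveTop (r : A → A → Prop) (x : A) : TopRanked (moveTop r x) x :=
  fun _ hy => Or.inl ⟨rfl, hy⟩

theorem IsPref.flip {r : A → A → Prop} (hr : IsPref r) : IsPref (flip r) :=
  ⟨fun x y hxy => (hr.1 x y hxy).symm, fun x y z hxy hyz => hr.2.1 z y x hyz hxy,
    fun x y => hr.2.2 y x⟩

theorem exists_isPref (A : Type*) [Fintype A] : ∃ r : A → A → Prop, IsPref r := by
  refine ⟨fun a b => Fintype.equivFin A a < Fintype.equivFin A b, fun x y hxy => ?_,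
    fun x y z => lt_trans, fun x y => lt_asymm⟩
  exact lt_or_gt_of_ne ((Fintype.equivFin A).injective.ne hxy)

theorem exists_isPref_topRanked [Fintype A] (x : A) :
    ∃ r : A → A → Prop, IsPref r ∧ TopRanked r x := by
  obtain ⟨r, hr⟩ := exists_isPref A
  exact ⟨moveTop r x, hr.moveTop x, topRanked_moveTop r x⟩

theorem exists_isPref_topTwo [Fintype A] {x y : A} (hxy : x ≠ y) :
    ∃ r : A → A → Prop, IsPref r ∧ TopRanked r x ∧ ∀ w, w ≠ x → w ≠ y → r y w := by
  obtain ⟨r, hr, hy⟩ := exists_isPref_topRanked y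
  exact ⟨moveTop r x, hr.moveTop x, topRanked_moveTop r x,
    fun w hwx hwy => Or.inr ⟨hy w hwy, hxy.symm, hwx⟩⟩

theorem exists_isPref_top_bottom [Fintype A] {x y : A} (hxy : x ≠ y) :
    ∃ r : A → A → Prop, IsPref r ∧ TopRanked r x ∧ ∀ w, w ≠ y → r w y := by
  obtain ⟨r, hr, hy⟩ := exists_isPref_topRanked y
  refine ⟨moveTop (flip r) x, hr.flip.moveTop x, topRanked_moveTop _ x, fun w hw => ?_⟩
  by_cases hwx : w = x
  · exact Or.inl ⟨hwx, hxy.symm⟩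
  · exact Or.inr ⟨hy w hw, hwx, hxy.symm⟩

theorem IsPref.exists_topRanked [Fintype A] [Nonempty A] {r : A → A → Prop} (hr : IsPref r) :
    ∃ x, TopRanked r x := by
  have : IsTrans A r := ⟨hr.2.1⟩
  have : Std.Irrefl r := ⟨fun a h => hr.2.2 a a h h⟩
  have wf := Finite.wellFounded_of_trans_of_irrefl r
  obtain ⟨x, -, hx⟩ := wf.has_min Set.univ Set.univ_nonempty
  exact ⟨x, fun y hy => (hr.1 x y hy.symm).resolve_right (hx y trivial)⟩

theorem TopRanked.eq {r : A → A → Prop} (hr : IsPref r) {x y : A} (hx : TopRanked r x)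
    (hy : TopRanked r y) : x = y := by
  by_contra h
  exact hr.2.2 x y (hx y (Ne.symm h)) (hy x h)

/-! ### Lotteries -/

theorem eq_zero_of_eq_one [Fintype A] {p : A → ℝ} (h0 : ∀ x, 0 ≤ p x) (h1 : ∑ x, p x = 1)
    {x y : A} (hx : p x = 1) (hy : y ≠ x) : p y = 0 := by
  have hsum : ∑ w ∈ univ.erase x, p w = 0 := by
    have := Finset.add_sum_erase univ p (mem_univ x)
    linarith
  exact (Finset.sum_eq_zero_iff_of_nonneg fun w _ => h0 w).1 hsum y (by simp [hy])

theorem eq_one_of_eq_zero [Fintype A] {p : A → ℝ} (h1 : ∑ x, p x = 1) {x : A}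
    (h : ∀ y, y ≠ x → p y = 0) : p x = 1 := by
  rw [← h1, Finset.sum_eq_single x (fun y _ hy => h y hy) (by simp)]

theorem add_eq_one_of_eq_zero [Fintype A] {p : A → ℝ} (h1 : ∑ x, p x = 1) {x y : A} (hxy : x ≠ y)
    (h : ∀ w, w ≠ x → w ≠ y → p w = 0) : p x + p y = 1 := by
  rw [← h1, Finset.sum_eq_add x y hxy (fun w _ hw => h w hw.1 hw.2) (by simp) (by simp)]

theorem SDdom.le_of_topRanked [Fintype A] {r : A → A → Prop} {p q : A → ℝ} (hr : IsPref r)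
    (h : SDdom r p q) {x : A} (hx : TopRanked r x) : q x ≤ p x := by
  have hUC : UC r x = {x} := by
    ext y
    simp only [UC, Set.mem_ofPred_eq, Set.mem_singleton_iff, or_iff_right_iff_imp]
    intro hyx
    by_contra hne
    exact hr.2.2 y x hyx (hx y hne)
  simpa [mass, hUC, Set.indicator_apply] using h x

theorem SDdom.eq_zero_of_eq_one_right [Fintype A] {r : A → A → Prop} {p q : A → ℝ} (hr : IsPref r)
    (h : SDdom r p q) (hp0 : ∀ x, 0 ≤ p x) (hp1 : ∑ x, p x = 1) (hq0 : ∀ x, 0 ≤ q x) {x b : A}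
    (hx : q x = 1) (hxb : r x b) : p b = 0 := by
  have hq : q x ≤ mass q (UC r x) := by
    have := Finset.single_le_sum (f := fun y => (UC r x).indicator q y)
      (fun y _ => Set.indicator_nonneg (fun z _ => hq0 z) y) (mem_univ x)
    simpa [UC, mass] using this
  have hb : b ∉ UC r x := by
    rintro (hbx | rfl)
    · exact hr.2.2 _ _ hxb hbx
    · exact hr.2.2 _ _ hxb hxb
  have hpb : mass p (UC r x) + p b ≤ 1 := by
    have hsplit := Finset.add_sum_erase univ p (mem_univ b)
    have hsplit' := Finset.add_sum_erase univ ((UC r x).indicator p) (mem_univ b)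
    have hle : ∑ w ∈ univ.erase b, (UC r x).indicator p w ≤ ∑ w ∈ univ.erase b, p w :=
      Finset.sum_le_sum fun w _ => Set.indicator_le_self' (fun z _ => hp0 z) w
    rw [Set.indicator_of_notMem hb] at hsplit'
    unfold mass
    linarith
  have := h x
  have := hp0 b
  linarith

theorem SDdom.eq_zero_of_eq_one_left [Fintype A] {r : A → A → Prop} {p q : A → ℝ} (hr : IsPref r)
    (h : SDdom r p q) (hp0 : ∀ x, 0 ≤ p x) (hp1 : ∑ x, p x = 1) (hq0 : ∀ x, 0 ≤ q x) {x b : A}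
    (hx : p x = 1) (hbx : r b x) : q b = 0 := by
  have hq : q b ≤ mass q (UC r b) := by
    have := Finset.single_le_sum (f := fun y => (UC r b).indicator q y)
      (fun y _ => Set.indicator_nonneg (fun z _ => hq0 z) y) (mem_univ b)
    simpa [UC, mass] using this
  have hp : mass p (UC r b) = 0 := by
    refine Finset.sum_eq_zero fun y _ => ?_
    by_cases hy : y ∈ UC r b
    · rw [Set.indicator_of_mem hy]
      refine eq_zero_of_eq_one hp0 hp1 hx ?_
      rintro rfl
      rcases hy with hy | rfl
      · exact hr.2.2 _ _ hbx hy
      · exact hr.2.2 _ _ hbx hbx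
    · exact Set.indicator_of_notMem hy p
  have := h b
  have := hq0 b
  linarith

theorem SDdom.of_eq_one [Fintype A] {r : A → A → Prop} {p q : A → ℝ} (hr : IsPref r)
    (hp0 : ∀ x, 0 ≤ p x) (hp1 : ∑ x, p x = 1) (hq0 : ∀ x, 0 ≤ q x) (hq1 : ∑ x, q x = 1) {x y : A}
    (hx : p x = 1) (hy : q y = 1) (hxy : r x y ∨ x = y) : SDdom r p q := by
  intro b
  have hmass : ∀ {u : A → ℝ} {w : A}, (∀ x, 0 ≤ u x) → ∑ x, u x = 1 → u w = 1 →
      mass u (UC r b) = if w ∈ UC r b then 1 else 0 := by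
    intro u w h0 h1 hw
    unfold mass
    rw [Finset.sum_eq_single w]
    · rw [Set.indicator_apply, hw]
    · intro v _ hv
      rw [Set.indicator_apply, eq_zero_of_eq_one h0 h1 hw hv, ite_self]
    · simp
  rw [hmass hp0 hp1 hx, hmass hq0 hq1 hy]
  have himp : y ∈ UC r b → x ∈ UC r b := by
    rcases hxy with hxy | rfl
    · rintro (hyb | rfl)
      · exact Or.inl (hr.2.1 _ _ _ hxy hyb)
      · exact Or.inl hxy
    · exact id
  split_ifs with h1 h2 <;> first | exact absurd (himp h1) h2 | norm_num

/-! ### The Condorcet domain -/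

theorem margin_eq (R : Prof n A) (x y : A) :
    margin R x y = (#{i | R i x y} : ℤ) - (#{i | R i y x} : ℤ) := by
  unfold margin
  rw [Nat.card_eq_fintype_card, Nat.card_eq_fintype_card, Fintype.card_subtype,
    Fintype.card_subtype]

theorem lt_two_mul_card_of_margin_pos {R : Prof n A} (hR : IsProf R) {x y : A} (hxy : x ≠ y)
    (h : 0 < margin R x y) : n < 2 * #{i | R i x y} := by
  have hcompl : ({i | R i y x} : Finset (Fin n)) = ({i | R i x y} : Finset (Fin n))ᶜ := by
    ext i
    simp only [mem_filter, mem_univ, true_and, mem_compl]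
    exact ⟨fun hyx => (hR i).2.2 _ _ hyx, ((hR i).1 x y hxy).resolve_left⟩
  have hcard := Finset.card_add_card_compl ({i | R i x y} : Finset (Fin n))
  rw [margin_eq, hcompl] at h
  rw [Fintype.card_fin] at hcard
  lia

theorem margin_pos_of_lt_two_mul_card {R : Prof n A} (hR : IsProf R) {x y : A} {J : Finset (Fin n)}
    (hJ : n < 2 * #J) (h : ∀ j ∈ J, R j x y) : 0 < margin R x y := by
  have h1 : #J ≤ #{i | R i x y} := Finset.card_le_card fun j hj => by simpa using h j hj
  have h2 : #{i | R i y x} ≤ #Jᶜ := Finset.card_le_card fun j hj => by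
    simp only [mem_filter, mem_univ, true_and] at hj
    exact mem_compl.2 fun hjJ => (hR j).2.2 _ _ hj (h j hjJ)
  have hcard := Finset.card_add_card_compl J
  rw [Fintype.card_fin] at hcard
  rw [margin_eq]
  lia

theorem CondorcetWinner.eq {R : Prof n A} {x y : A} (hx : CondorcetWinner R x)
    (hy : CondorcetWinner R y) : x = y := by
  by_contra hne
  have h1 := hx y (Ne.symm hne)
  have h2 := hy x hne
  unfold margin at h1 h2
  lia

theorem condorcetWinner_of_majority {R : Prof n A} (hR : IsProf R) {x : A} {J : Finset (Fin n)}
    (hJ : n < 2 * #J) (h : ∀ j ∈ J, TopRanked (R j) x) : CondorcetWinner R x :=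
  fun y hy => margin_pos_of_lt_two_mul_card hR hJ fun j hj => h j hj y hy

theorem mem_condorcetDomain_of_majority {R : Prof n A} (hR : IsProf R) {x : A}
    {J : Finset (Fin n)} (hJ : n < 2 * #J) (h : ∀ j ∈ J, TopRanked (R j) x) :
    R ∈ CondorcetDomain n A :=
  ⟨hR, x, condorcetWinner_of_majority hR hJ h⟩

theorem mem_condorcetDomain_of_split {R : Prof n A} (hR : IsProf R) {x y : A} {J : Finset (Fin n)}
    (hJ : 2 * #J ≠ n) (hx : ∀ j ∈ J, TopRanked (R j) x) (hy : ∀ j ∉ J, TopRanked (R j) y) :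
    R ∈ CondorcetDomain n A := by
  rcases lt_or_gt_of_ne hJ with h | h
  · refine mem_condorcetDomain_of_majority (J := Jᶜ) hR ?_ fun j hj => hy j (mem_compl.1 hj)
    have := Finset.card_add_card_compl J
    rw [Fintype.card_fin] at this
    lia
  · exact mem_condorcetDomain_of_majority hR h hx

theorem two_mul_card_compl_ne {J : Finset (Fin n)} (hJ : 2 * #J ≠ n) : 2 * #Jᶜ ≠ n := by
  have := Finset.card_add_card_compl J
  rw [Fintype.card_fin] at this
  lia

theorem IsProf.ite {R R' : Prof n A} (hR : IsProf R) (hR' : IsProf R') (J : Finset (Fin n)) :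
    IsProf (fun i => if i ∈ J then R i else R' i) := by
  intro i
  dsimp only
  split_ifs
  exacts [hR i, hR' i]

/-! ### Coalitions -/

/-- The profile in which the members of `J` report `r` and all other voters report `s`. -/
def splitProf (J : Finset (Fin n)) (r s : A → A → Prop) : Prof n A :=
  fun i => if i ∈ J then r else s

theorem splitProf_of_mem {J : Finset (Fin n)} {i : Fin n} (hi : i ∈ J) (r s : A → A → Prop) :
    splitProf J r s i = r := if_pos hi

theorem splitProf_of_notMem {J : Finset (Fin n)} {i : Fin n} (hi : i ∉ J) (r s : A → A → Prop) :
    splitProf J r s i = s := if_neg hi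

theorem splitProf_compl (J : Finset (Fin n)) (r s : A → A → Prop) :
    splitProf Jᶜ s r = splitProf J r s := by
  funext i
  by_cases hi : i ∈ J <;> simp [splitProf, hi]

theorem isProf_splitProf (J : Finset (Fin n)) {r s : A → A → Prop} (hr : IsPref r)
    (hs : IsPref s) : IsProf (splitProf J r s) := by
  intro i
  unfold splitProf
  split_ifs
  exacts [hr, hs]

theorem splitProf_mem_condorcetDomain {J : Finset (Fin n)} (hJ : 2 * #J ≠ n)
    {r s : A → A → Prop} (hr : IsPref r) (hs : IsPref s) {x y : A} (hx : TopRanked r x)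
    (hy : TopRanked s y) : splitProf J r s ∈ CondorcetDomain n A :=
  mem_condorcetDomain_of_split (isProf_splitProf J hr hs) hJ
    (fun j hj => by rwa [splitProf_of_mem hj]) (fun j hj => by rwa [splitProf_of_notMem hj])

variable {f : Prof n A → A → ℝ}

/-- The coalition `J` enforces `x` against `y` under `f`: whenever its members top-rank `x` and all
other voters top-rank `y`, the alternative `x` is chosen with probability `1`. -/
def Enforces (f : Prof n A → A → ℝ) (J : Finset (Fin n)) (x y : A) : Prop :=
  ∀ R : Prof n A, IsProf R → (∀ j ∈ J, TopRanked (R j) x) → (∀ j ∉ J, TopRanked (R j) y) →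
    f R x = 1

theorem Enforces.splitProf_eq_one {J : Finset (Fin n)} {x y : A} (h : Enforces f J x y)
    {r s : A → A → Prop} (hr : IsPref r) (hs : IsPref s) (hx : TopRanked r x)
    (hy : TopRanked s y) : f (splitProf J r s) x = 1 :=
  h _ (isProf_splitProf J hr hs) (fun j hj => by rwa [splitProf_of_mem hj])
    (fun j hj => by rwa [splitProf_of_notMem hj])

/-! ### Consequences of group-strategyproofness -/

variable [Fintype A]

theorem GroupStrategyproof.eq_zero_of_forall_pref (hf : IsSDS (CondorcetDomain n A) f)
    (hG : GroupStrategyproof (CondorcetDomain n A) f) {R R' : Prof n A}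
    (hR : R ∈ CondorcetDomain n A) (hR' : R' ∈ CondorcetDomain n A) {I : Finset (Fin n)}
    (hI : ∀ j ∉ I, R j = R' j) {z b : A} (hz : f R' z = 1) (hbz : b ≠ z)
    (hpref : ∀ i ∈ I, R i z b) : f R b = 0 := by
  rcases I.eq_empty_or_nonempty with rfl | hne
  · obtain rfl : R = R' := funext fun j => hI j (by simp)
    exact eq_zero_of_eq_one (hf R hR).1 (hf R hR).2 hz hbz
  · obtain ⟨i, hi, hSD⟩ := hG R hR R' hR' I hne hI
    exact hSD.eq_zero_of_eq_one_right (hR.1 i) (hf R hR).1 (hf R hR).2 (hf R' hR').1 hz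
      (hpref i hi)

theorem GroupStrategyproof.eq_zero_after_deviation (hf : IsSDS (CondorcetDomain n A) f)
    (hG : GroupStrategyproof (CondorcetDomain n A) f) {R R' : Prof n A}
    (hR : R ∈ CondorcetDomain n A) (hR' : R' ∈ CondorcetDomain n A) {I : Finset (Fin n)}
    (hI : ∀ j ∉ I, R j = R' j) {x b : A} (hx : f R x = 1) (hbx : b ≠ x)
    (hpref : ∀ i ∈ I, R i b x) : f R' b = 0 := by
  rcases I.eq_empty_or_nonempty with rfl | hne
  · obtain rfl : R = R' := funext fun j => hI j (by simp)
    exact eq_zero_of_eq_one (hf R hR).1 (hf R hR).2 hx hbx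
  · obtain ⟨i, hi, hSD⟩ := hG R hR R' hR' I hne hI
    exact hSD.eq_zero_of_eq_one_left (hR.1 i) (hf R hR).1 (hf R hR).2 (hf R' hR').1 hx
      (hpref i hi)

theorem GroupStrategyproof.le_of_topRanked (hG : GroupStrategyproof (CondorcetDomain n A) f)
    {R R' : Prof n A} (hR : R ∈ CondorcetDomain n A) (hR' : R' ∈ CondorcetDomain n A)
    {I : Finset (Fin n)} (hI : ∀ j ∉ I, R j = R' j) {x : A} (hx : ∀ i ∈ I, TopRanked (R i) x) :
    f R' x ≤ f R x := by
  rcases I.eq_empty_or_nonempty with rfl | hne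
  · obtain rfl : R = R' := funext fun j => hI j (by simp)
    exact le_rfl
  · obtain ⟨i, hi, hSD⟩ := hG R hR R' hR' I hne hI
    exact hSD.le_of_topRanked (hR.1 i) (hx i hi)

theorem GroupStrategyproof.eq_of_topRanked (hG : GroupStrategyproof (CondorcetDomain n A) f)
    {R R' : Prof n A} (hR : R ∈ CondorcetDomain n A) (hR' : R' ∈ CondorcetDomain n A)
    {I : Finset (Fin n)} (hI : ∀ j ∉ I, R j = R' j) {x : A} (hx : ∀ i ∈ I, TopRanked (R i) x)
    (hx' : ∀ i ∈ I, TopRanked (R' i) x) : f R x = f R' x :=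
  le_antisymm (hG.le_of_topRanked hR' hR (fun j hj => (hI j hj).symm) hx')
    (hG.le_of_topRanked hR hR' hI hx)

theorem GroupStrategyproof.eq_one_of_unanimous (hn : 3 ≤ n) (hf : IsSDS (CondorcetDomain n A) f)
    (hG : GroupStrategyproof (CondorcetDomain n A) f)
    (hN : NonImposing (CondorcetDomain n A) f) {R : Prof n A} (hR : IsProf R) {x : A}
    (hx : ∀ i, TopRanked (R i) x) : R ∈ CondorcetDomain n A ∧ f R x = 1 := by
  have hRD : R ∈ CondorcetDomain n A :=
    mem_condorcetDomain_of_majority (J := univ) hR (by simp; lia) fun j _ => hx j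
  obtain ⟨R', hR', hx'⟩ := hN x
  refine ⟨hRD, le_antisymm ?_ ?_⟩
  · rw [← (hf R hRD).2]
    exact Finset.single_le_sum (fun y _ => (hf R hRD).1 y) (mem_univ x)
  · rw [← hx']
    exact hG.le_of_topRanked (I := univ) hRD hR' (by simp) fun i _ => hx i

theorem GroupStrategyproof.exists_forall_eq_zero (hn : 3 ≤ n) (hf : IsSDS (CondorcetDomain n A) f)
    (hG : GroupStrategyproof (CondorcetDomain n A) f)
    (hN : NonImposing (CondorcetDomain n A) f) {R : Prof n A} (hR : R ∈ CondorcetDomain n A)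
    (x : A) : ∃ i, ∀ b, R i x b → f R b = 0 := by
  obtain ⟨r, hr, hx⟩ := exists_isPref_topRanked x
  obtain ⟨hD, h1⟩ := hG.eq_one_of_unanimous hn hf hN (R := fun _ => r) (fun _ => hr) fun _ => hx
  have : NeZero n := ⟨by lia⟩
  obtain ⟨i, -, hSD⟩ := hG R hR _ hD univ univ_nonempty (by simp)
  exact ⟨i, fun b hb =>
    hSD.eq_zero_of_eq_one_right (hR.1 i) (hf R hR).1 (hf R hR).2 (hf _ hD).1 h1 hb⟩

theorem GroupStrategyproof.expostEfficient (hn : 3 ≤ n) (hf : IsSDS (CondorcetDomain n A) f)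
    (hG : GroupStrategyproof (CondorcetDomain n A) f)
    (hN : NonImposing (CondorcetDomain n A) f) : ExPostEfficient (CondorcetDomain n A) f := by
  intro R hR x y hxy
  obtain ⟨i, hi⟩ := hG.exists_forall_eq_zero hn hf hN hR x
  exact hi y (hxy i)

/-! ### Winning coalitions -/

theorem GroupStrategyproof.splitProf_add_eq_one (hn : 3 ≤ n) (hf : IsSDS (CondorcetDomain n A) f)
    (hG : GroupStrategyproof (CondorcetDomain n A) f)
    (hN : NonImposing (CondorcetDomain n A) f) {J : Finset (Fin n)} (hJ : 2 * #J ≠ n)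
    {r s : A → A → Prop} (hr : IsPref r) (hs : IsPref s) {x y : A} (hxy : x ≠ y)
    (hx : TopRanked r x) (hy : TopRanked s y) (hyx : ∀ w, w ≠ y → w ≠ x → s x w) :
    f (splitProf J r s) x + f (splitProf J r s) y = 1 := by
  have hD := splitProf_mem_condorcetDomain hJ hr hs hx hy
  refine add_eq_one_of_eq_zero (hf _ hD).2 hxy fun w hwx hwy =>
    hG.expostEfficient hn hf hN _ hD x w fun i => ?_
  unfold splitProf
  split_ifs
  exacts [hx w hwx, hyx w hwy hwx]

theorem GroupStrategyproof.enforces_of_splitProf (hn : 3 ≤ n)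
    (hf : IsSDS (CondorcetDomain n A) f) (hG : GroupStrategyproof (CondorcetDomain n A) f)
    (hN : NonImposing (CondorcetDomain n A) f) {J : Finset (Fin n)} (hJ : 2 * #J ≠ n)
    {r s : A → A → Prop} (hr : IsPref r) (hs : IsPref s) {x y : A} (hxy : x ≠ y)
    (hx : TopRanked r x) (hxw : ∀ w, w ≠ x → w ≠ y → r y w) (hy : TopRanked s y)
    (h : f (splitProf J r s) x = 1) : Enforces f J x y := by
  intro R hR hRx hRy
  have hD := splitProf_mem_condorcetDomain hJ hr hs hx hy
  have hRD := mem_condorcetDomain_of_split hR hJ hRx hRy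
  set R₁ : Prof n A := fun i => if i ∈ J then r else R i with hR₁
  have hin : ∀ j ∈ J, R₁ j = r := fun j hj => if_pos hj
  have hout : ∀ j ∉ J, R₁ j = R j := fun j hj => if_neg hj
  have hD₁ : R₁ ∈ CondorcetDomain n A :=
    mem_condorcetDomain_of_split (IsProf.ite (fun _ => hr) hR J) hJ
      (fun j hj => by rwa [hin j hj]) (fun j hj => by rw [hout j hj]; exact hRy j hj)
  have hy0 : f R₁ y = 0 := by
    rw [hG.eq_of_topRanked (I := Jᶜ) (x := y) hD₁ hD]
    · exact eq_zero_of_eq_one (hf _ hD).1 (hf _ hD).2 h hxy.symm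
    · intro j hj
      rw [mem_compl, not_not] at hj
      rw [hin j hj, splitProf_of_mem hj]
    · intro j hj
      rw [hout j (mem_compl.1 hj)]
      exact hRy j (mem_compl.1 hj)
    · intro j hj
      rwa [splitProf_of_notMem (mem_compl.1 hj)]
  have hx1 : f R₁ x = 1 := by
    refine eq_one_of_eq_zero (hf _ hD₁).2 fun w hw => ?_
    by_cases hwy : w = y
    · rwa [hwy]
    · refine hG.expostEfficient hn hf hN _ hD₁ y w fun i => ?_
      by_cases hi : i ∈ J
      · rw [hin i hi]
        exact hxw w hw hwy
      · rw [hout i hi]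
        exact hRy i hi w hwy
  rw [← hx1]
  exact hG.eq_of_topRanked hRD hD₁ (fun j hj => (hout j hj).symm) hRx
    fun j hj => by rwa [hin j hj]

theorem exists_ne_ne (hA : 3 ≤ Fintype.card A) (x y : A) : ∃ z, z ≠ x ∧ z ≠ y := by
  obtain ⟨z, hz⟩ : ∃ z, z ∉ ({x, y} : Finset A) := by
    by_contra! h
    have h1 : Fintype.card A ≤ #({x, y} : Finset A) :=
      Finset.card_le_card fun z _ => h z
    have := Finset.card_le_two (a := x) (b := y)
    lia
  exact ⟨z, by simpa using hz⟩

theorem GroupStrategyproof.enforces_or_enforces_compl (hn : 3 ≤ n) (hA : 3 ≤ Fintype.card A)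
    (hf : IsSDS (CondorcetDomain n A) f) (hG : GroupStrategyproof (CondorcetDomain n A) f)
    (hN : NonImposing (CondorcetDomain n A) f) {J : Finset (Fin n)} (hJ : 2 * #J ≠ n) {x y : A}
    (hxy : x ≠ y) : Enforces f J x y ∨ Enforces f Jᶜ y x := by
  obtain ⟨z, hzx, hzy⟩ := exists_ne_ne hA x y
  obtain ⟨r₁, hr₁, hr₁x, hr₁y⟩ := exists_isPref_topTwo hxy
  obtain ⟨s₁, hs₁, hs₁y, hs₁x⟩ := exists_isPref_topTwo hxy.symm
  obtain ⟨r₂, hr₂, hr₂x, hr₂z⟩ := exists_isPref_topTwo hzx.symm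
  obtain ⟨s₂, hs₂, hs₂y, hs₂z⟩ := exists_isPref_topTwo hzy.symm
  have hJ' := two_mul_card_compl_ne hJ
  have hD : ∀ {r s : A → A → Prop}, IsPref r → IsPref s → TopRanked r x → TopRanked s y →
      splitProf J r s ∈ CondorcetDomain n A := fun hr hs hx hy =>
    splitProf_mem_condorcetDomain hJ hr hs hx hy
  have hx_eq : ∀ {r r' s : A → A → Prop}, IsPref r → IsPref r' → IsPref s → TopRanked r x →
      TopRanked r' x → TopRanked s y → f (splitProf J r s) x = f (splitProf J r' s) x :=
    fun hr hr' hs hx hx' hy => hG.eq_of_topRanked (I := J) (hD hr hs hx hy) (hD hr' hs hx' hy)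
      (fun j hj => by rw [splitProf_of_notMem hj, splitProf_of_notMem hj])
      (fun j hj => by rwa [splitProf_of_mem hj]) (fun j hj => by rwa [splitProf_of_mem hj])
  have hy_eq : ∀ {r s s' : A → A → Prop}, IsPref r → IsPref s → IsPref s' → TopRanked r x →
      TopRanked s y → TopRanked s' y → f (splitProf J r s) y = f (splitProf J r s') y :=
    fun hr hs hs' hx hy hy' => hG.eq_of_topRanked (I := Jᶜ) (hD hr hs hx hy) (hD hr hs' hx hy')
      (fun j hj => by
        rw [mem_compl, not_not] at hj
        rw [splitProf_of_mem hj, splitProf_of_mem hj])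
      (fun j hj => by rwa [splitProf_of_notMem (mem_compl.1 hj)])
      (fun j hj => by rwa [splitProf_of_notMem (mem_compl.1 hj)])
  have h11 := hG.splitProf_add_eq_one hn hf hN hJ hr₁ hs₁ hxy hr₁x hs₁y hs₁x
  have h21 := hG.splitProf_add_eq_one hn hf hN hJ hr₂ hs₁ hxy hr₂x hs₁y hs₁x
  have h12 := hG.splitProf_add_eq_one hn hf hN hJ' hs₂ hr₁ hxy.symm hs₂y hr₁x hr₁y
  rw [splitProf_compl] at h12
  have e1 := hx_eq hr₁ hr₂ hs₁ hr₁x hr₂x hs₁y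
  have e2 := hx_eq hr₁ hr₂ hs₂ hr₁x hr₂x hs₂y
  have e3 := hy_eq hr₂ hs₁ hs₂ hr₂x hs₁y hs₂y
  have e4 := hy_eq hr₁ hs₁ hs₂ hr₁x hs₁y hs₂y
  obtain ⟨i, hi⟩ := hG.exists_forall_eq_zero hn hf hN (hD hr₂ hs₂ hr₂x hs₂y) z
  by_cases hiJ : i ∈ J
  · have := hi y (by rw [splitProf_of_mem hiJ]; exact hr₂z y hxy.symm hzy.symm)
    exact Or.inl (hG.enforces_of_splitProf hn hf hN hJ hr₁ hs₁ hxy hr₁x hr₁y hs₁y (by linarith))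
  · have := hi x (by rw [splitProf_of_notMem hiJ]; exact hs₂z x hxy hzx.symm)
    refine Or.inr (hG.enforces_of_splitProf hn hf hN hJ' hs₁ hr₁ hxy.symm hs₁y hs₁x hr₁x ?_)
    rw [splitProf_compl]
    linarith

theorem GroupStrategyproof.enforces_change_right (hn : 3 ≤ n) (hA : 3 ≤ Fintype.card A)
    (hf : IsSDS (CondorcetDomain n A) f) (hG : GroupStrategyproof (CondorcetDomain n A) f)
    (hN : NonImposing (CondorcetDomain n A) f) {J : Finset (Fin n)} (hJ : 2 * #J ≠ n) {x y z : A}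
    (hzx : z ≠ x) (h : Enforces f J x y) (hxy : x ≠ y) : Enforces f J x z := by
  by_cases hzy : z = y
  · rwa [hzy]
  refine (hG.enforces_or_enforces_compl hn hA hf hN hJ hzx.symm).resolve_right fun hc => ?_
  obtain ⟨r, hr, hrx⟩ := exists_isPref_topRanked x
  obtain ⟨s, hs, hsy, hsz⟩ := exists_isPref_topTwo (Ne.symm hzy)
  obtain ⟨s', hs', hs'z⟩ := exists_isPref_topRanked z
  have h1 := h.splitProf_eq_one hr hs hrx hsy
  have h2 := hc.splitProf_eq_one hs' hr hs'z hrx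
  rw [splitProf_compl] at h2
  have h3 := hG.eq_zero_of_forall_pref (I := Jᶜ) (b := x) hf
    (splitProf_mem_condorcetDomain hJ hr hs hrx hsy)
    (splitProf_mem_condorcetDomain hJ hr hs' hrx hs'z)
    (fun j hj => by
      rw [mem_compl, not_not] at hj
      rw [splitProf_of_mem hj, splitProf_of_mem hj]) h2 hzx.symm
    (fun j hj => by
      rw [splitProf_of_notMem (mem_compl.1 hj)]
      exact hsz x hxy hzx.symm)
  linarith

theorem GroupStrategyproof.enforces_change_left (hn : 3 ≤ n) (hA : 3 ≤ Fintype.card A)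
    (hf : IsSDS (CondorcetDomain n A) f) (hG : GroupStrategyproof (CondorcetDomain n A) f)
    (hN : NonImposing (CondorcetDomain n A) f) {J : Finset (Fin n)} (hJ : 2 * #J ≠ n) {x y z : A}
    (hzy : z ≠ y) (h : Enforces f J x y) (hxy : x ≠ y) : Enforces f J z y := by
  by_cases hzx : z = x
  · rwa [hzx]
  refine (hG.enforces_or_enforces_compl hn hA hf hN hJ hzy).resolve_right fun hc => ?_
  obtain ⟨r, hr, hrz, hrx⟩ := exists_isPref_topTwo hzx
  obtain ⟨r', hr', hr'x⟩ := exists_isPref_topRanked x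
  obtain ⟨s, hs, hsy⟩ := exists_isPref_topRanked y
  have h1 := hc.splitProf_eq_one hs hr hsy hrz
  rw [splitProf_compl] at h1
  have h2 := h.splitProf_eq_one hr' hs hr'x hsy
  have h3 := hG.eq_zero_of_forall_pref (I := J) (b := y) hf
    (splitProf_mem_condorcetDomain hJ hr hs hrz hsy)
    (splitProf_mem_condorcetDomain hJ hr' hs hr'x hsy)
    (fun j hj => by rw [splitProf_of_notMem hj, splitProf_of_notMem hj]) h2 hxy.symm
    (fun j hj => by
      rw [splitProf_of_mem hj]
      exact hrx y hzy.symm hxy.symm)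
  linarith

theorem GroupStrategyproof.enforces_neutral (hn : 3 ≤ n) (hA : 3 ≤ Fintype.card A)
    (hf : IsSDS (CondorcetDomain n A) f) (hG : GroupStrategyproof (CondorcetDomain n A) f)
    (hN : NonImposing (CondorcetDomain n A) f) {J : Finset (Fin n)} (hJ : 2 * #J ≠ n) {x y u v : A}
    (hxy : x ≠ y) (h : Enforces f J x y) (huv : u ≠ v) : Enforces f J u v := by
  have right : ∀ {a b c : A}, a ≠ b → c ≠ a → Enforces f J a b → Enforces f J a c :=
    fun hab hca h => hG.enforces_change_right hn hA hf hN hJ hca h hab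
  have left : ∀ {a b c : A}, a ≠ b → c ≠ b → Enforces f J a b → Enforces f J c b :=
    fun hab hcb h => hG.enforces_change_left hn hA hf hN hJ hcb h hab
  obtain ⟨w, hwx, hwu⟩ := exists_ne_ne hA x u
  exact right hwu.symm huv.symm (left hwx.symm hwu.symm (right hxy hwx h))

theorem GroupStrategyproof.enforces_singleton_or (hn : 3 ≤ n) (hA : 3 ≤ Fintype.card A)
    (hf : IsSDS (CondorcetDomain n A) f) (hG : GroupStrategyproof (CondorcetDomain n A) f)
    (hN : NonImposing (CondorcetDomain n A) f) {i : Fin n} {K : Finset (Fin n)} (hi : i ∉ K)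
    (hK : 2 * #(insert i K) < n) (h : ∀ x y, x ≠ y → Enforces f (insert i K) x y) :
    (∀ x y, x ≠ y → Enforces f {i} x y) ∨ ∀ x y, x ≠ y → Enforces f K x y := by
  have hcard := Finset.card_insert_of_notMem hi
  have hi2 : 2 * #({i} : Finset (Fin n)) ≠ n := by simp; lia
  have hK2 : 2 * #K ≠ n := by lia
  obtain ⟨x, y, hxy⟩ := Fintype.exists_pair_of_one_lt_card (α := A) (by lia)
  obtain ⟨z, hzx, hzy⟩ := exists_ne_ne hA x y
  by_cases hi_xz : Enforces f {i} x z
  · exact Or.inl fun u v huv => hG.enforces_neutral hn hA hf hN hi2 hzx.symm hi_xz huv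
  by_cases hK_zy : Enforces f K z y
  · exact Or.inr fun u v huv => hG.enforces_neutral hn hA hf hN hK2 hzy hK_zy huv
  exfalso
  have hi_zx := (hG.enforces_or_enforces_compl hn hA hf hN hi2 hzx.symm).resolve_left hi_xz
  have hK_yz := (hG.enforces_or_enforces_compl hn hA hf hN hK2 hzy).resolve_left hK_zy
  obtain ⟨a, ha, hax, hay⟩ := exists_isPref_topTwo hxy
  obtain ⟨b, hb, hbz, hbx⟩ := exists_isPref_topTwo hzx
  obtain ⟨c, hc, hcy, hcz⟩ := exists_isPref_topTwo hzy.symm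
  have hmem : ∀ {p q r : A → A → Prop}, IsPref p → IsPref q → IsPref r →
      ∀ {t : A}, TopRanked r t →
      (fun j => if j = i then p else if j ∈ K then q else r : Prof n A) ∈
        CondorcetDomain n A := by
    intro p q r hp hq hr t ht
    refine mem_condorcetDomain_of_majority (x := t) (J := (insert i K)ᶜ) (fun j => ?_) ?_ ?_
    · split_ifs
      exacts [hp, hq, hr]
    · have := Finset.card_add_card_compl (insert i K)
      rw [Fintype.card_fin] at this
      lia
    · intro j hj
      rw [mem_compl, mem_insert, not_or] at hj
      rw [if_neg hj.1, if_neg hj.2]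
      exact ht
  have hR := hmem ha hb hc hcy
  set R : Prof n A := fun j => if j = i then a else if j ∈ K then b else c with hRdef
  have hRi : R i = a := if_pos rfl
  have hRK : ∀ j ∈ K, R j = b := fun j hj => by
    rw [hRdef]
    dsimp only
    rw [if_neg (by rintro rfl; exact hi hj), if_pos hj]
  have hRc : ∀ j, j ≠ i → j ∉ K → R j = c := fun j hji hj => by
    rw [hRdef]
    dsimp only
    rw [if_neg hji, if_neg hj]
  -- the voters in `insert i K` can enforce `x`
  have hx0 : ∀ w, w ≠ x → w ≠ z → f R w = 0 := by
    intro w hwx hwz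
    have hD' := hmem ha ha hc hcy
    refine hG.eq_zero_of_forall_pref (I := insert i K) (z := x) hf hR hD' ?_ ?_ hwx ?_
    · intro j hj
      rw [mem_insert, not_or] at hj
      rw [hRc j hj.1 hj.2, if_neg hj.1, if_neg hj.2]
    · refine h x y hxy _ hD'.1 (fun j hj => ?_) (fun j hj => ?_)
      · rw [mem_insert] at hj
        rcases hj with hj | hj
        · rwa [if_pos hj]
        · rw [if_pos hj, ite_self]
          exact hax
      · rw [mem_insert, not_or] at hj
        rwa [if_neg hj.1, if_neg hj.2]
    · intro j hj
      rw [mem_insert] at hj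
      rcases hj with rfl | hj
      · rw [hRi]
        exact hax w hwx
      · rw [hRK j hj]
        exact hbx w hwz hwx
  -- voter `i` can induce `y`
  have hz0 : f R z = 0 := by
    have hD' := hmem hc hb hc hcy
    refine hG.eq_zero_of_forall_pref (I := {i}) (z := y) hf hR hD' ?_ ?_ hzy ?_
    · intro j hj
      rw [mem_singleton] at hj
      by_cases hjK : j ∈ K
      · rw [hRK j hjK, if_neg hj, if_pos hjK]
      · rw [hRc j hj hjK, if_neg hj, if_neg hjK]
    · refine hK_yz _ hD'.1 (fun j hj => ?_) (fun j hj => ?_)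
      · rw [mem_compl] at hj
        rw [if_neg hj, ite_self]
        exact hcy
      · rw [mem_compl, not_not] at hj
        rw [if_neg (by rintro rfl; exact hi hj), if_pos hj]
        exact hbz
    · intro j hj
      rw [mem_singleton] at hj
      rw [hj, hRi]
      exact hay z hzx hzy
  -- the voters outside `insert i K` can induce `z`
  have hx0' : f R x = 0 := by
    have hD' := hmem ha hb hb hbz
    refine hG.eq_zero_of_forall_pref (I := (insert i K)ᶜ) (z := z) hf hR hD' ?_ ?_ hzx.symm ?_
    · intro j hj
      rw [mem_compl, not_not, mem_insert] at hj
      rcases hj with rfl | hj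
      · rw [hRi, if_pos rfl]
      · rw [hRK j hj, if_neg (by rintro rfl; exact hi hj), if_pos hj]
    · refine hi_zx _ hD'.1 (fun j hj => ?_) (fun j hj => ?_)
      · rw [mem_compl, mem_singleton] at hj
        rw [if_neg hj, ite_self]
        exact hbz
      · rw [mem_compl, not_not, mem_singleton] at hj
        rwa [if_pos hj]
    · intro j hj
      rw [mem_compl, mem_insert, not_or] at hj
      rw [hRc j hj.1 hj.2]
      exact hcz x hxy hzx.symm
  have := add_eq_one_of_eq_zero (hf R hR).2 hzx.symm hx0
  linarith

theorem GroupStrategyproof.exists_enforces_singleton (hn : 3 ≤ n) (hA : 3 ≤ Fintype.card A)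
    (hf : IsSDS (CondorcetDomain n A) f) (hG : GroupStrategyproof (CondorcetDomain n A) f)
    (hN : NonImposing (CondorcetDomain n A) f) (J : Finset (Fin n)) (hJ : 2 * #J < n)
    (h : ∀ x y, x ≠ y → Enforces f J x y) : ∃ i, ∀ x y, x ≠ y → Enforces f {i} x y := by
  induction J using Finset.induction_on with
  | empty =>
    obtain ⟨x, y, hxy⟩ := Fintype.exists_pair_of_one_lt_card (α := A) (by lia)
    obtain ⟨r, hr, hy⟩ := exists_isPref_topRanked y
    obtain ⟨hD, h1⟩ :=
      hG.eq_one_of_unanimous hn hf hN (R := fun _ => r) (fun _ => hr) fun _ => hy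
    have h2 := h x y hxy (fun _ => r) (fun _ => hr) (by simp) fun _ _ => hy
    have h3 := eq_zero_of_eq_one (hf _ hD).1 (hf _ hD).2 h1 hxy
    linarith
  | insert i K hi ih =>
    rcases hG.enforces_singleton_or hn hA hf hN hi hJ h with h' | h'
    · exact ⟨i, h'⟩
    · have := Finset.card_insert_of_notMem hi
      exact ih (by lia) h'

/-- A coalition that enforces every alternative against every other one
also gets its common favourite when the other voters disagree. -/
theorem GroupStrategyproof.eq_one_of_enforces (hA : 3 ≤ Fintype.card A)
    (hf : IsSDS (CondorcetDomain n A) f) (hG : GroupStrategyproof (CondorcetDomain n A) f)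
    {J : Finset (Fin n)} (hJ : 2 * #J ≠ n) (h : ∀ x y, x ≠ y → Enforces f J x y) {R : Prof n A}
    (hR : R ∈ CondorcetDomain n A) {x : A} (hx : ∀ j ∈ J, TopRanked (R j) x) : f R x = 1 := by
  obtain ⟨y, hyx, -⟩ := exists_ne_ne hA x x
  obtain ⟨s, hs, hsy, hsx⟩ := exists_isPref_top_bottom hyx
  set R' : Prof n A := fun j => if j ∈ J then R j else s with hR'
  have hin : ∀ j ∈ J, R' j = R j := fun j hj => if_pos hj
  have hout : ∀ j ∉ J, R' j = s := fun j hj => if_neg hj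
  have hP : IsProf R' := IsProf.ite hR.1 (fun _ => hs) J
  have hx' : ∀ j ∈ J, TopRanked (R' j) x := fun j hj => by rw [hin j hj]; exact hx j hj
  have hy' : ∀ j ∉ J, TopRanked (R' j) y := fun j hj => by rwa [hout j hj]
  refine eq_one_of_eq_zero (hf R hR).2 fun b hb => ?_
  refine hG.eq_zero_after_deviation (I := Jᶜ) hf (mem_condorcetDomain_of_split hP hJ hx' hy') hR
    (fun j hj => ?_) (h x y hyx.symm R' hP hx' hy') hb fun j hj => ?_
  · rw [mem_compl, not_not] at hj
    exact hin j hj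
  · rw [hout j (mem_compl.1 hj)]
    exact hsx b hb

theorem eq_dict_of_eq_one (hf : IsSDS (CondorcetDomain n A) f) [Nonempty A] {i : Fin n}
    (h : ∀ R ∈ CondorcetDomain n A, ∀ x, TopRanked (R i) x → f R x = 1) :
    ∀ R ∈ CondorcetDomain n A, ∀ x, f R x = dict i R x := by
  intro R hR x
  obtain ⟨t, ht⟩ := (hR.1 i).exists_topRanked
  unfold dict
  split_ifs with hx
  · exact h R hR x hx
  · refine eq_zero_of_eq_one (hf R hR).1 (hf R hR).2 (h R hR t ht) ?_
    rintro rfl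
    exact hx ht

theorem eq_condRule_of_eq_one (hf : IsSDS (CondorcetDomain n A) f)
    (h : ∀ R ∈ CondorcetDomain n A, ∀ x, CondorcetWinner R x → f R x = 1) :
    ∀ R ∈ CondorcetDomain n A, ∀ x, f R x = CondRule R x := by
  intro R hR x
  obtain ⟨c, hc⟩ := hR.2
  unfold CondRule
  split_ifs with hx
  · exact h R hR x hx
  · refine eq_zero_of_eq_one (hf R hR).1 (hf R hR).2 (h R hR c hc) ?_
    rintro rfl
    exact hx hc

theorem GroupStrategyproof.eq_condRule_of_majority_enforces (hA : 3 ≤ Fintype.card A)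
    (hf : IsSDS (CondorcetDomain n A) f) (hG : GroupStrategyproof (CondorcetDomain n A) f)
    (h : ∀ J : Finset (Fin n), n < 2 * #J → ∀ x y, x ≠ y → Enforces f J x y) :
    ∀ R ∈ CondorcetDomain n A, ∀ x, f R x = CondRule R x := by
  refine eq_condRule_of_eq_one hf fun R hR c hc => eq_one_of_eq_zero (hf R hR).2 fun b hb => ?_
  have hI := lt_two_mul_card_of_margin_pos hR.1 hb.symm (hc b hb)
  set I : Finset (Fin n) := {i | R i c b} with hIdef
  obtain ⟨r, hr, hrc⟩ := exists_isPref_topRanked c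
  set R' : Prof n A := fun j => if j ∈ I then r else R j with hR'
  have hin : ∀ j ∈ I, TopRanked (R' j) c := fun j hj => by
    rw [hR']
    dsimp only
    rwa [if_pos hj]
  have hD' : R' ∈ CondorcetDomain n A :=
    mem_condorcetDomain_of_majority (IsProf.ite (fun _ => hr) hR.1 I) hI hin
  refine hG.eq_zero_of_forall_pref (I := I) (R' := R') hf hR hD' (fun j hj => (if_neg hj).symm)
    (hG.eq_one_of_enforces hA hf (by lia) (h I hI) hD' hin) hb fun j hj => ?_
  simpa [hIdef] using hj

theorem GroupStrategyproof.dict_or_condRule (hn : 3 ≤ n) (hA : 3 ≤ Fintype.card A)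
    (hf : IsSDS (CondorcetDomain n A) f) (hG : GroupStrategyproof (CondorcetDomain n A) f)
    (hN : NonImposing (CondorcetDomain n A) f) :
    (∃ i : Fin n, ∀ R ∈ CondorcetDomain n A, ∀ x, f R x = dict i R x) ∨
      ∀ R ∈ CondorcetDomain n A, ∀ x, f R x = CondRule R x := by
  by_cases h : ∀ J : Finset (Fin n), n < 2 * #J → ∀ x y, x ≠ y → Enforces f J x y
  · exact Or.inr (hG.eq_condRule_of_majority_enforces hA hf h)
  · push Not at h
    obtain ⟨J, hJ, x, y, hxy, hJxy⟩ := h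
    have hcard := Finset.card_add_card_compl J
    rw [Fintype.card_fin] at hcard
    have hJc := (hG.enforces_or_enforces_compl hn hA hf hN (by lia) hxy).resolve_left hJxy
    obtain ⟨i, hi⟩ := hG.exists_enforces_singleton hn hA hf hN Jᶜ (by lia) fun u v huv =>
      hG.enforces_neutral hn hA hf hN (by lia) hxy.symm hJc huv
    have : Nonempty A := ⟨x⟩
    refine Or.inl ⟨i, eq_dict_of_eq_one hf fun R hR t ht => ?_⟩
    exact hG.eq_one_of_enforces hA hf (by simp; lia) hi hR (by simpa using ht)

/-! ### Dictatorships and the Condorcet rule -/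

theorem nonImposing_of_unanimous (hn : 3 ≤ n)
    (h : ∀ R ∈ CondorcetDomain n A, ∀ x, (∀ i, TopRanked (R i) x) → f R x = 1) :
    NonImposing (CondorcetDomain n A) f := by
  intro x
  obtain ⟨r, hr, hx⟩ := exists_isPref_topRanked x
  have hD : (fun _ => r : Prof n A) ∈ CondorcetDomain n A :=
    mem_condorcetDomain_of_majority (J := univ) (fun _ => hr) (by simp; lia) fun _ _ => hx
  exact ⟨_, hD, h _ hD x fun _ => hx⟩

theorem groupStrategyproof_of_eq_dict [Nonempty A] (hf : IsSDS (CondorcetDomain n A) f)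
    {i : Fin n} (h : ∀ R ∈ CondorcetDomain n A, ∀ x, f R x = dict i R x) :
    GroupStrategyproof (CondorcetDomain n A) f := by
  intro R hR R' hR' I hne hI
  have hone : ∀ {Q : Prof n A} {x : A}, Q ∈ CondorcetDomain n A → TopRanked (Q i) x → f Q x = 1 :=
    fun hQ hx => by rw [h _ hQ, dict, if_pos hx]
  obtain ⟨t, ht⟩ := (hR.1 i).exists_topRanked
  obtain ⟨t', ht'⟩ := (hR'.1 i).exists_topRanked
  by_cases hi : i ∈ I
  · refine ⟨i, hi, SDdom.of_eq_one (hR.1 i) (hf R hR).1 (hf R hR).2 (hf R' hR').1 (hf R' hR').2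
      (hone hR ht) (hone hR' ht') ?_⟩
    by_cases htt : t = t'
    · exact Or.inr htt
    · exact Or.inl (ht t' (Ne.symm htt))
  · obtain ⟨k, hk⟩ := hne
    rw [← hI i hi] at ht'
    exact ⟨k, hk, SDdom.of_eq_one (hR.1 k) (hf R hR).1 (hf R hR).2 (hf R' hR').1 (hf R' hR').2
      (hone hR ht) (hone hR' (by rwa [← hI i hi])) (Or.inr (TopRanked.eq (hR.1 i) ht ht'))⟩

theorem groupStrategyproof_of_eq_condRule (hf : IsSDS (CondorcetDomain n A) f)
    (h : ∀ R ∈ CondorcetDomain n A, ∀ x, f R x = CondRule R x) :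
    GroupStrategyproof (CondorcetDomain n A) f := by
  intro R hR R' hR' I hne hI
  have hone : ∀ {Q : Prof n A} {x : A}, Q ∈ CondorcetDomain n A → CondorcetWinner Q x →
      f Q x = 1 := fun hQ hx => by rw [h _ hQ, CondRule, if_pos hx]
  obtain ⟨c, hc⟩ := hR.2
  obtain ⟨c', hc'⟩ := hR'.2
  obtain ⟨k, hk, hkc⟩ : ∃ k ∈ I, R k c c' ∨ c = c' := by
    by_cases hcc : c = c'
    · obtain ⟨k, hk⟩ := hne
      exact ⟨k, hk, Or.inr hcc⟩
    · by_contra! hcon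
      have hmaj := lt_two_mul_card_of_margin_pos hR.1 hcc (hc c' (Ne.symm hcc))
      have h1 : 0 < margin R' c c' := by
        refine margin_pos_of_lt_two_mul_card hR'.1 hmaj fun j hj => ?_
        simp only [mem_filter, mem_univ, true_and] at hj
        rw [← hI j fun hjI => (hcon j hjI).1 hj]
        exact hj
      have h2 := hc' c hcc
      unfold margin at h1 h2
      lia
  exact ⟨k, hk, SDdom.of_eq_one (hR.1 k) (hf R hR).1 (hf R hR).2 (hf R' hR').1 (hf R' hR').2
    (hone hR hc) (hone hR' hc') hkc⟩

end GroupStrategyproof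

/-- For `n ≥ 3`, an SDS on the Condorcet domain is group-strategyproof and
non-imposing iff it is a dictatorship or the Condorcet rule. -/
theorem groupStrategyproof_condorcetDomain_characterization {n : ℕ} {A : Type*} [Fintype A]
    (hn : 3 ≤ n) (hA : 3 ≤ Fintype.card A)
    (f : Prof n A → A → ℝ) (hf : IsSDS (CondorcetDomain n A) f) :
    (GroupStrategyproof (CondorcetDomain n A) f ∧ NonImposing (CondorcetDomain n A) f) ↔
      ((∃ i : Fin n, ∀ R ∈ CondorcetDomain n A, ∀ x, f R x = dict i R x) ∨
        (∀ R ∈ CondorcetDomain n A, ∀ x, f R x = CondRule R x)) := by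
  constructor
  · rintro ⟨hG, hN⟩
    exact hG.dict_or_condRule hn hA hf hN
  · rintro (⟨i, hi⟩ | h)
    · have : Nonempty A := Fintype.card_pos_iff.1 (by lia)
      refine ⟨groupStrategyproof_of_eq_dict hf hi, nonImposing_of_unanimous hn fun R hR x hx => ?_⟩
      rw [hi R hR, dict, if_pos (hx i)]
    · refine ⟨groupStrategyproof_of_eq_condRule hf h,
        nonImposing_of_unanimous hn fun R hR x hx => ?_⟩
      rw [h R hR, CondRule, if_pos]
      exact condorcetWinner_of_majority (J := univ) hR.1 (by simp; lia) fun j _ => hx j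
end

section
/- Assume the number of voters n ≥ 4 is even and fix a preference relation ▷. The tie-breaking Condorcet rule COND^▷ is strategyproof on the tie-breaking Condorcet domain D_C^▷. -/
open scoped Classical
open Finset

theorem margin_swap {n : ℕ} {A : Type*} (R : Prof n A) (x y : A) :
    margin R y x = -margin R x y := by
  unfold margin
  ring

theorem CondorcetWinner.unique {n : ℕ} {A : Type*} {R : Prof n A} {x y : A}
    (hx : CondorcetWinner R x) (hy : CondorcetWinner R y) : x = y := by
  by_contra h
  have h₁ := hx y (Ne.symm h)
  have h₂ := hy x h
  rw [margin_swap] at h₂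
  linarith

/-- The margin of `y` over `x` cannot grow if only voters preferring `y` to `x` change
their preferences. -/
theorem margin_le_margin {n : ℕ} {A : Type*} {R R' : Prof n A} {x y : A}
    (h : ∀ j, R j = R' j ∨ (R j y x ∧ ¬ R j x y)) : margin R' y x ≤ margin R y x := by
  have h₁ : Nat.card {j // R' j y x} ≤ Nat.card {j // R j y x} :=
    Nat.card_mono (Set.toFinite {j | R j y x}) fun j (hj : R' j y x) => by
      rcases h j with e | e
      · exact (congrFun₂ e y x).mpr hj
      · exact e.1
  have h₂ : Nat.card {j // R j x y} ≤ Nat.card {j // R' j x y} :=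
    Nat.card_mono (Set.toFinite {j | R' j x y}) fun j (hj : R j x y) => by
      rcases h j with e | e
      · exact (congrFun₂ e x y).mp hj
      · exact absurd hj e.2
  unfold margin
  omega

theorem mass_tieCondRule {n : ℕ} {A : Type*} [Fintype A] {t : A → A → Prop}
    {R : Prof n A} {x : A} (hx : CondorcetWinner (tieProf R t) x) (S : Set A) :
    mass (TieCondRule t R) S = if x ∈ S then 1 else 0 := by
  have h : ∀ y, CondorcetWinner (tieProf R t) y ↔ y = x :=
    fun y => ⟨fun hy => hy.unique hx, fun e => e ▸ hx⟩
  unfold mass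
  rw [Finset.sum_eq_single x]
  · simp [Set.indicator_apply, TieCondRule, hx]
  · intro y _ hy
    simp [TieCondRule, h, hy]
  · simp

/-- For even `n ≥ 4`, the tie-breaking Condorcet rule is strategyproof on the
tie-breaking Condorcet domain. -/
theorem tieCondRule_strategyproof {n : ℕ} {A : Type*} [Fintype A]
    (hn : 4 ≤ n) (heven : Even n) (hA : 3 ≤ Fintype.card A)
    (t : A → A → Prop) (ht : IsPref t) :
    Strategyproof (TieCondorcetDomain n t) (TieCondRule t) := by
  rintro R ⟨hR, x, hx⟩ R' ⟨-, y, hy⟩ i hi z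
  rw [mass_tieCondRule hx, mass_tieCondRule hy]
  obtain ⟨hcompl, htrans, hasymm⟩ := hR i
  have hxy : x = y ∨ R i x y := by
    by_contra! hne
    have hyx : R i y x := (hcompl x y hne.1).resolve_left hne.2
    have hle : margin (tieProf R' t) y x ≤ margin (tieProf R t) y x := by
      refine margin_le_margin (Fin.cases (Or.inl rfl) fun j => ?_)
      by_cases hj : j = i
      · subst hj
        exact Or.inr ⟨hyx, hne.2⟩
      · exact Or.inl (hi j hj)
    have h₁ := hx y (Ne.symm hne.1)
    have h₂ := hy x hne.1
    rw [margin_swap (tieProf R t) x y] at hle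
    linarith
  have himp : y ∈ UC (R i) z → x ∈ UC (R i) z := by
    rcases hxy with rfl | hxy
    · exact id
    · rintro (h | rfl)
      · exact Or.inl (htrans _ _ _ hxy h)
      · exact Or.inl hxy
  by_cases h : y ∈ UC (R i) z
  · simp [h, himp h]
  · rw [if_neg h]
    split_ifs <;> norm_num
end
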